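/- Let A be a real N_x×N_x matrix and B a real N_x×N_u matrix, regarded over ℝ(z), and let Φ_u be an N_u×N_x matrix over ℝ(z) such that I + B·Φ_u is invertible; set Φ_x := (zI − A)⁻¹·(I + B·Φ_u). Suppose vectors x (of dimension N_x), u (of dimension N_u), and δ (of dimension N_x), all with entries in ℝ(z), together with injected signals d_x, d_u, d_δ (of dimensions N_x, N_u, N_x), satisfy the closed-loop equations z·x = A·x + B·u + d_x, u = (z·Φ_u)·δ + d_u, and δ = −z⁻¹·B·(z·Φ_u)·δ + (I − z⁻¹·A)·x + d_δ. Then x = Φ_x·d_x + Φ_x·B·d_u + (zI − A)⁻¹·B·(z·Φ_u)·d_δ, u = Φ_u·d_x + (I + Φ_u·B)·d_u + (z·Φ_u)·d_δ, and δ = z⁻¹·d_x + z⁻¹·B·d_u + d_δ. -/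

import Mathlib

set_option synthInstance.maxHeartbeats 1000000
set_option maxHeartbeats 1000000

open Matrix

/-- The matrix `z I - A` over the field `ℝ(z)`, with the real matrix `A`
embedded via the constant embedding. -/
noncomputable def zIsubA {Nx : ℕ} (A : Matrix (Fin Nx) (Fin Nx) ℝ) :
    Matrix (Fin Nx) (Fin Nx) (RatFunc ℝ) :=
  Matrix.scalar (Fin Nx) (RatFunc.X : RatFunc ℝ) - A.map (algebraMap ℝ (RatFunc ℝ))

theorem zIsubA_eq_map_charmatrix {Nx : ℕ} (A : Matrix (Fin Nx) (Fin Nx) ℝ) :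
    zIsubA A = A.charmatrix.map (algebraMap (Polynomial ℝ) (RatFunc ℝ)) := by
  ext i j
  by_cases h : i = j
  · subst h
    simp [zIsubA, Matrix.charmatrix_apply_eq, RatFunc.algebraMap_eq_C]
  · simp [zIsubA, h, RatFunc.algebraMap_eq_C]

theorem isUnit_det_zIsubA {Nx : ℕ} (A : Matrix (Fin Nx) (Fin Nx) ℝ) :
    IsUnit (zIsubA A).det := by
  have hdet : (zIsubA A).det = algebraMap (Polynomial ℝ) (RatFunc ℝ) A.charpoly := by
    rw [zIsubA_eq_map_charmatrix, Matrix.charpoly, RingHom.map_det]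
    rfl
  rw [hdet, isUnit_iff_ne_zero]
  exact RatFunc.algebraMap_ne_zero A.charpoly_monic.ne_zero

/-- closed-loop transfer matrices of the simplified SLS controller.
With `Φx := (zI - A)⁻¹ (I + B Φu)`, if the closed-loop signals satisfy
`z x = A x + B u + d_x`, `u = (z Φu) δ + d_u`, and
`δ = -z⁻¹ B (z Φu) δ + (I - z⁻¹ A) x + d_δ`, then
`x = Φx d_x + Φx B d_u + (zI - A)⁻¹ B (z Φu) d_δ`,
`u = Φu d_x + (I + Φu B) d_u + (z Φu) d_δ`, and
`δ = z⁻¹ d_x + z⁻¹ B d_u + d_δ`. -/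
theorem sls_internal_transfer_matrices (Nx Nu : ℕ)
    (A : Matrix (Fin Nx) (Fin Nx) ℝ) (B : Matrix (Fin Nx) (Fin Nu) ℝ)
    (Φu : Matrix (Fin Nu) (Fin Nx) (RatFunc ℝ))
    (hinv : IsUnit (1 + B.map (algebraMap ℝ (RatFunc ℝ)) * Φu))
    (Φx : Matrix (Fin Nx) (Fin Nx) (RatFunc ℝ))
    (hΦx : Φx = (zIsubA A)⁻¹ * (1 + B.map (algebraMap ℝ (RatFunc ℝ)) * Φu))
    (x δ dx dδ : Fin Nx → RatFunc ℝ) (u du : Fin Nu → RatFunc ℝ)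
    (hx : (RatFunc.X : RatFunc ℝ) • x =
      (A.map (algebraMap ℝ (RatFunc ℝ))) *ᵥ x +
        (B.map (algebraMap ℝ (RatFunc ℝ))) *ᵥ u + dx)
    (hu : u = ((RatFunc.X : RatFunc ℝ) • Φu) *ᵥ δ + du)
    (hδ : δ = -(((RatFunc.X : RatFunc ℝ)⁻¹ •
          (B.map (algebraMap ℝ (RatFunc ℝ)) * ((RatFunc.X : RatFunc ℝ) • Φu))) *ᵥ δ) +
        ((1 - (RatFunc.X : RatFunc ℝ)⁻¹ • A.map (algebraMap ℝ (RatFunc ℝ))) *ᵥ x) + dδ) :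
    x = Φx *ᵥ dx + (Φx * B.map (algebraMap ℝ (RatFunc ℝ))) *ᵥ du +
        ((zIsubA A)⁻¹ * B.map (algebraMap ℝ (RatFunc ℝ)) *
          ((RatFunc.X : RatFunc ℝ) • Φu)) *ᵥ dδ ∧
    u = Φu *ᵥ dx + (1 + Φu * B.map (algebraMap ℝ (RatFunc ℝ))) *ᵥ du +
        ((RatFunc.X : RatFunc ℝ) • Φu) *ᵥ dδ ∧
    δ = (RatFunc.X : RatFunc ℝ)⁻¹ • dx +
        ((RatFunc.X : RatFunc ℝ)⁻¹ • B.map (algebraMap ℝ (RatFunc ℝ))) *ᵥ du + dδ := by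
  set A' := A.map (algebraMap ℝ (RatFunc ℝ))
  set B' := B.map (algebraMap ℝ (RatFunc ℝ))
  have hz : (RatFunc.X : RatFunc ℝ) ≠ 0 := RatFunc.X_ne_zero
  have hstate : zIsubA A *ᵥ x = B' *ᵥ u + dx := by
    have hscalar : zIsubA A *ᵥ x = (RatFunc.X : RatFunc ℝ) • x - A' *ᵥ x := by
      rw [zIsubA, sub_mulVec, scalar_apply, ← smul_one_eq_diagonal, smul_mulVec, one_mulVec]
    rw [hscalar, hx]
    abel
  have hδ' : δ = (RatFunc.X : RatFunc ℝ)⁻¹ • dx +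
      ((RatFunc.X : RatFunc ℝ)⁻¹ • B') *ᵥ du + dδ := by
    have hx' : x = (RatFunc.X : RatFunc ℝ)⁻¹ • (A' *ᵥ x + B' *ᵥ u + dx) := by
      rw [← hx, inv_smul_smul₀ hz]
    have hu' : B' *ᵥ u = (B' * ((RatFunc.X : RatFunc ℝ) • Φu)) *ᵥ δ + B' *ᵥ du := by
      conv_lhs => rw [hu]
      rw [mulVec_add, mulVec_mulVec]
    have hsub : (1 - (RatFunc.X : RatFunc ℝ)⁻¹ • A') *ᵥ x =
        (RatFunc.X : RatFunc ℝ)⁻¹ • (B' *ᵥ u + dx) := by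
      rw [sub_mulVec, one_mulVec, smul_mulVec]
      nth_rewrite 1 [hx']
      simp only [smul_add]
      abel
    rw [hsub, hu', smul_mulVec] at hδ
    rw [smul_mulVec]
    refine hδ.trans ?_
    simp only [smul_add]
    abel
  have hu' : u = Φu *ᵥ dx + (1 + Φu * B') *ᵥ du +
      ((RatFunc.X : RatFunc ℝ) • Φu) *ᵥ dδ := by
    refine hu.trans ?_
    rw [hδ']
    simp only [mulVec_add, add_mulVec, one_mulVec, smul_mulVec, mulVec_smul, Matrix.smul_mul,
      inv_smul_smul₀ hz, mulVec_mulVec]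
    abel
  refine ⟨?_, hu', hδ'⟩
  have hsol : x = (zIsubA A)⁻¹ *ᵥ (B' *ᵥ u + dx) := by
    rw [← hstate, mulVec_mulVec, nonsing_inv_mul _ (isUnit_det_zIsubA A), one_mulVec]
  refine hsol.trans ?_
  rw [hu', hΦx]
  simp only [mulVec_add, mulVec_mulVec, Matrix.mul_add, Matrix.add_mul, add_mulVec,
    Matrix.mul_one, Matrix.mul_assoc]
  abel
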